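/- Let a > 0 and l ∈ ℕ₀. Let f : ℝ → ℂ be continuous with f(x) = O(|x|^{-a}) as |x| → ∞, and assume f is C^l on some neighborhood of 0. Then the map α ↦ x_+^α(f) = (1/Γ(α+1)) ∫₀^∞ f(x) x^α dx, initially defined for -1 < Re α < a - 1, extends uniquely to a holomorphic function on the strip {α ∈ ℂ : -l - 1 < Re α < a - 1}. -/

import Mathlib

open Complex MeasureTheory Filter Asymptotics Set

/-- `x₊^α(f) = (1/Γ(α+1)) ∫₀^∞ f(x) x^α dx`. -/
noncomputable def xplus (f : ℝ → ℂ) (α : ℂ) : ℂ :=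
  (Complex.Gamma (α + 1))⁻¹ * ∫ x in Set.Ioi (0 : ℝ), f x * (x : ℂ) ^ α

open scoped Topology

/-- The function `s ↦ 1 / (Γ(s) (s + k))`, continued to an entire function. -/
noncomputable def gammaInvDivAdd (k : ℕ) (s : ℂ) : ℂ :=
  (ascPochhammer ℂ k).eval s * (Complex.Gamma (s + k + 1))⁻¹

theorem differentiable_gammaInvDivAdd (k : ℕ) : Differentiable ℂ (gammaInvDivAdd k) := by
  unfold gammaInvDivAdd
  refine (Polynomial.differentiable _).mul ?_
  exact differentiable_one_div_Gamma.comp ((differentiable_id.add_const _).add_const _)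

theorem gammaInvDivAdd_eq (k : ℕ) {s : ℂ} (hs : 0 < s.re) :
    gammaInvDivAdd k s = (Complex.Gamma s)⁻¹ * (1 / (s + k)) := by
  have hne : ∀ m : ℕ, s ≠ -m := by
    rintro m rfl
    have : (0 : ℝ) ≤ m := m.cast_nonneg
    simp at hs
    linarith
  have hsk : s + k ≠ 0 := fun h => hne k (eq_neg_of_add_eq_zero_left h)
  have hG : Complex.Gamma (s + k) ≠ 0 := by
    refine Complex.Gamma_ne_zero_of_re_pos ?_
    have : (0 : ℝ) ≤ k := k.cast_nonneg
    simp
    linarith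
  have hGs := Complex.Gamma_ne_zero_of_re_pos hs
  rw [gammaInvDivAdd, ← Complex.Gamma_add_nat_div_Gamma_eq s hne, Complex.Gamma_add_one _ hsk]
  field_simp

/-- The polynomial `∑ k < n, c k * x ^ k` cut off outside `(0, 1]`. -/
noncomputable def cutPoly (c : ℕ → ℂ) (n : ℕ) (x : ℝ) : ℂ :=
  (Ioc (0 : ℝ) 1).indicator (fun t : ℝ => ∑ k ∈ Finset.range n, c k * (t : ℂ) ^ k) x

theorem hasMellin_cutPoly (c : ℕ → ℂ) (n : ℕ) {s : ℂ} (hs : 0 < s.re) :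
    HasMellin (cutPoly c n) s (∑ k ∈ Finset.range n, c k * (1 / (s + k))) := by
  induction n with
  | zero =>
    have : cutPoly c 0 = fun _ => 0 := by ext; simp [cutPoly]
    simp [this, HasMellin, MellinConvergent, mellin]
  | succ n ih =>
    have hk : HasMellin (indicator (Ioc 0 1) (fun t => ↑t ^ (n : ℂ) : ℝ → ℂ)) s (1 / (s + n)) := by
      apply hasMellin_cpow_Ioc
      have : (0 : ℝ) ≤ n := n.cast_nonneg
      simp
      linarith
    have hck := hasMellin_const_smul hk.1 (c n)
    have h := hasMellin_add ih.1 hck.1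
    rw [ih.2, hck.2, hk.2, smul_eq_mul] at h
    rw [Finset.sum_range_succ]
    convert h using 1
    ext x
    by_cases hx : x ∈ Ioc (0 : ℝ) 1 <;>
      simp [cutPoly, hx, Finset.sum_range_succ]

theorem locallyIntegrableOn_cutPoly (c : ℕ → ℂ) (n : ℕ) (s : Set ℝ) :
    LocallyIntegrableOn (cutPoly c n) s := by
  have h : Continuous fun t : ℝ => ∑ k ∈ Finset.range n, c k * (t : ℂ) ^ k := by fun_prop
  exact (h.locallyIntegrable.indicator measurableSet_Ioc).locallyIntegrableOn s

theorem ContDiffAt.exists_polynomial_sub_isBigO {f : ℝ → ℂ} {l : ℕ} (hf : ContDiffAt ℝ l f 0) :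
    ∃ c : ℕ → ℂ, (fun x : ℝ => f x - ∑ k ∈ Finset.range l, c k * (x : ℂ) ^ k)
      =O[𝓝[>] 0] fun x : ℝ => x ^ l := by
  cases l with
  | zero =>
    refine ⟨0, ?_⟩
    simpa using (hf.continuousAt.tendsto.isBigO_one ℝ).mono nhdsWithin_le_nhds
  | succ n =>
    obtain ⟨u, hu, hfu⟩ := hf.contDiffOn (m := (n + 1 : ℕ)) le_rfl (by simp)
    obtain ⟨ε, hε, hεu⟩ := Metric.mem_nhds_iff.1
      (show u ∈ 𝓝 (0 : ℝ) by simpa using hu)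
    have hsub : Icc 0 (ε / 2) ⊆ u := fun x hx => hεu <| by
      rw [Metric.mem_ball, dist_zero_right, Real.norm_eq_abs, abs_of_nonneg hx.1]
      linarith [hx.2]
    obtain ⟨C, hC⟩ := exists_taylor_mean_remainder_bound (half_pos hε).le
      (by exact_mod_cast hfu.mono hsub : ContDiffOn ℝ (n + 1) f (Icc 0 (ε / 2)))
    refine ⟨fun k => ((k.factorial : ℝ)⁻¹ : ℝ) * iteratedDerivWithin k f (Icc 0 (ε / 2)) 0,
      IsBigO.of_bound C ?_⟩
    filter_upwards [Ioc_mem_nhdsGT (half_pos hε)] with x hx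
    have h := hC x ⟨hx.1.le, hx.2⟩
    rw [taylor_within_apply, sub_zero] at h
    rw [norm_pow, Real.norm_eq_abs, abs_of_pos hx.1]
    refine le_of_eq_of_le (congrArg (fun z => ‖f x - z‖) (Finset.sum_congr rfl fun k _ => ?_)) h
    simp only [Complex.real_smul]
    push_cast
    ring

/-- Holomorphic functions on a vertical strip which agree on a smaller strip are equal. -/
theorem eqOn_strip_of_eqOn_substrip {F G : ℂ → ℂ} {p q r : ℝ} (hpq : p ≤ q) (hqr : q < r)
    (hF : DifferentiableOn ℂ F {z | p < z.re ∧ z.re < r})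
    (hG : DifferentiableOn ℂ G {z | p < z.re ∧ z.re < r})
    (h : EqOn F G {z | q < z.re ∧ z.re < r}) : EqOn F G {z | p < z.re ∧ z.re < r} := by
  have hopen : ∀ t : ℝ, IsOpen {z : ℂ | t < z.re ∧ z.re < r} := fun t =>
    (isOpen_lt continuous_const continuous_re).inter (isOpen_lt continuous_re continuous_const)
  have hconv : Convex ℝ {z : ℂ | p < z.re ∧ z.re < r} :=
    (convex_halfSpace_re_gt p).inter (convex_halfSpace_re_lt r)
  have hz : (((q + r) / 2 : ℝ) : ℂ) ∈ {z : ℂ | q < z.re ∧ z.re < r} := by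
    constructor <;> rw [ofReal_re] <;> linarith
  exact (hF.analyticOnNhd (hopen p)).eqOn_of_preconnected_of_eventuallyEq
    (hG.analyticOnNhd (hopen p)) hconv.isPreconnected ⟨hpq.trans_lt hz.1, hz.2⟩
    (h.eventuallyEq_of_mem ((hopen q).mem_nhds hz))

theorem xplus_eq_mellin (f : ℝ → ℂ) (α : ℂ) :
    xplus f α = (Complex.Gamma (α + 1))⁻¹ * mellin f (α + 1) := by
  simp [xplus, mellin, mul_comm]

theorem stmt_1 (a : ℝ) (ha : 0 < a) (l : ℕ)
    (f : ℝ → ℂ) (hfc : Continuous f)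
    (hdecay : f =O[cocompact ℝ] fun x => |x| ^ (-a))
    (O : Set ℝ) (hO : IsOpen O) (h0O : (0 : ℝ) ∈ O)
    (hCl : ContDiffOn ℝ l f O) :
    ∃ F : ℂ → ℂ,
      DifferentiableOn ℂ F {α : ℂ | -(l : ℝ) - 1 < α.re ∧ α.re < a - 1} ∧
      (∀ α : ℂ, -1 < α.re → α.re < a - 1 → F α = xplus f α) ∧
      (∀ G : ℂ → ℂ,
        DifferentiableOn ℂ G {α : ℂ | -(l : ℝ) - 1 < α.re ∧ α.re < a - 1} →
        (∀ α : ℂ, -1 < α.re → α.re < a - 1 → G α = xplus f α) →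
        EqOn G F {α : ℂ | -(l : ℝ) - 1 < α.re ∧ α.re < a - 1}) := by
  obtain ⟨c, hc⟩ := (hCl.contDiffAt (hO.mem_nhds h0O)).exists_polynomial_sub_isBigO
  set g : ℝ → ℂ := fun x => f x - cutPoly c l x with hg
  have hg_int : LocallyIntegrableOn g (Ioi 0) :=
    (hfc.locallyIntegrable.locallyIntegrableOn _).sub (locallyIntegrableOn_cutPoly c l _)
  have hg_top : g =O[atTop] (· ^ (-a)) := by
    refine (hdecay.mono (atTop_le_cocompact)).congr' ?_ ?_
    · filter_upwards [eventually_gt_atTop 1] with x hx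
      simp [hg, cutPoly, hx]
    · filter_upwards [eventually_gt_atTop 0] with x hx
      rw [abs_of_pos hx]
  have hg_bot : g =O[𝓝[>] 0] (· ^ (-(-l : ℝ))) := by
    refine hc.congr' ?_ ?_
    · filter_upwards [Ioc_mem_nhdsGT one_pos] with x hx
      simp only [hg, cutPoly, indicator_of_mem hx]
    · filter_upwards with x
      simp
  have hg_diff : ∀ α : ℂ, -(l : ℝ) - 1 < α.re → α.re < a - 1 →
      DifferentiableAt ℂ (fun α => mellin g (α + 1)) α := fun α h1 h2 => by
    have := mellin_differentiableAt_of_isBigO_rpow (s := α + 1) hg_int hg_top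
      (by rw [add_re, one_re]; linarith) hg_bot (by rw [add_re, one_re]; linarith)
    exact DifferentiableAt.comp (g := mellin g) α this (differentiableAt_id.add_const 1)
  have hl : (0 : ℝ) ≤ l := l.cast_nonneg
  let F : ℂ → ℂ := fun α => (Complex.Gamma (α + 1))⁻¹ * mellin g (α + 1) +
    ∑ k ∈ Finset.range l, c k * gammaInvDivAdd k (α + 1)
  have hF : DifferentiableOn ℂ F {α : ℂ | -(l : ℝ) - 1 < α.re ∧ α.re < a - 1} := by
    rintro α ⟨h1, h2⟩
    refine DifferentiableAt.differentiableWithinAt (.add (.mul ?_ (hg_diff α h1 h2)) ?_)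
    · exact (differentiable_one_div_Gamma.comp (differentiable_id.add_const 1)) α
    · refine DifferentiableAt.fun_sum fun k _ => .const_mul ?_ _
      exact ((differentiable_gammaInvDivAdd k).comp (differentiable_id.add_const 1)) α
  have hFx : ∀ α : ℂ, -1 < α.re → α.re < a - 1 → F α = xplus f α := fun α h1 h2 => by
    have hs : 0 < (α + 1).re := by simp; linarith
    have hcut := hasMellin_cutPoly c l hs
    have hadd := (hasMellin_add (mellinConvergent_of_isBigO_rpow hg_int hg_top
      (by rw [add_re, one_re]; linarith) hg_bot (by linarith)) hcut.1).2
    simp only [hg, sub_add_cancel] at hadd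
    simp only [F]
    rw [xplus_eq_mellin, hadd, hcut.2, mul_add, Finset.mul_sum]
    refine congrArg _ (Finset.sum_congr rfl fun k _ => ?_)
    rw [gammaInvDivAdd_eq k hs]
    ring
  refine ⟨F, hF, hFx, fun G hG hGx => ?_⟩
  refine eqOn_strip_of_eqOn_substrip (q := -1) (by linarith) (by linarith) hG hF ?_
  rintro α ⟨h1, h2⟩
  rw [hGx α h1 h2, hFx α h1 h2]
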